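/- Let u : H^2 → R be a positive smooth solution of Δu - 2u = 0 on the hyperbolic plane. Then there is a universal constant C₀ (independent of u) such that ||grad u||/u ≤ C₀ everywhere on H^2. -/

import Mathlib

/-- The conformal factor of the Poincaré metric on the unit disk:
g = e^{2f} g_Euc, f = log(2/(1-|z|²)). -/
noncomputable def fconf (z : ℂ) : ℝ := Real.log (2 / (1 - ‖z‖ ^ 2))

/-- The Euclidean Laplacian of u : ℂ → ℝ. -/
noncomputable def lapE (u : ℂ → ℝ) (z : ℂ) : ℝ :=
  fderiv ℝ (fun w => fderiv ℝ u w 1) z 1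
    + fderiv ℝ (fun w => fderiv ℝ u w Complex.I) z Complex.I

/-- The Euclidean norm of the Euclidean gradient of u. -/
noncomputable def gradNormE (u : ℂ → ℝ) (z : ℂ) : ℝ :=
  Real.sqrt ((fderiv ℝ u z 1) ^ 2 + (fderiv ℝ u z Complex.I) ^ 2)

open Set MeasureTheory

lemma param_deriv {F F' : ℝ → ℝ → ℝ}
    (hF : ∀ r ∈ Ioo (-1:ℝ) 1, Continuous (F r))
    (hF' : ContinuousOn (Function.uncurry F') (Ioo (-1:ℝ) 1 ×ˢ univ))
    (hd : ∀ r ∈ Ioo (-1:ℝ) 1, ∀ t, HasDerivAt (fun r => F r t) (F' r t) r)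
    {r : ℝ} (hr : r ∈ Ioo (-1:ℝ) 1) (b : ℝ) :
    HasDerivAt (fun r => ∫ t in (0:ℝ)..b, F r t) (∫ t in (0:ℝ)..b, F' r t) r := by
  obtain ⟨δ, hδ, hsub⟩ := Metric.isOpen_iff.1 (isOpen_Ioo (a := (-1:ℝ)) (b := 1)) r hr
  have hsub' : Metric.closedBall r (δ/2) ⊆ Ioo (-1:ℝ) 1 :=
    (Metric.closedBall_subset_ball (by linarith)).trans hsub
  have hK : IsCompact (Metric.closedBall r (δ/2) ×ˢ uIcc 0 b) :=
    (isCompact_closedBall r (δ/2)).prod isCompact_uIcc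
  obtain ⟨C, hC⟩ := hK.exists_bound_of_continuousOn
    (hF'.mono (prod_mono hsub' (subset_univ _)))
  have hc : Continuous (F' r) := by
    have := hF'.comp_continuous (f := fun t : ℝ => ((r, t) : ℝ × ℝ)) (by fun_prop)
      (fun t => ⟨hr, mem_univ _⟩)
    exact this
  refine (intervalIntegral.hasDerivAt_integral_of_dominated_loc_of_deriv_le
    (s := Metric.closedBall r (δ/2)) (bound := fun _ => C)
    (Metric.closedBall_mem_nhds r (by linarith)) ?_ ?_ ?_ ?_ ?_ ?_).2
  · filter_upwards [isOpen_Ioo.mem_nhds hr] with x hx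
    exact (hF x hx).aestronglyMeasurable
  · exact (hF r hr).intervalIntegrable _ _
  · exact hc.aestronglyMeasurable
  · exact ae_of_all _ fun t ht x hx => hC (x, t) ⟨hx, uIoc_subset_uIcc ht⟩
  · exact intervalIntegrable_const
  · exact ae_of_all _ fun t ht x hx => hd x (hsub' hx) t

lemma mvt0 {f : ℝ → ℝ} {a b : ℝ} (hab : a < b) (hc : ContinuousOn f (Icc a b))
    (hd : ∀ x ∈ Ioo a b, HasDerivAt f 0 x) : f b = f a := by
  obtain ⟨c, _, h⟩ := exists_hasDerivAt_eq_slope f (fun _ => 0) hab hc hd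
  rw [eq_comm, div_eq_zero_iff] at h
  rcases h with h | h <;> linarith

/-- Wronskian vanishing. -/
lemma wronsk {A A1 A2 p p1 p2 W : ℝ → ℝ}
    (hA : ∀ r ∈ Ioo (-1:ℝ) 1, HasDerivAt A (A1 r) r)
    (hA1 : ∀ r ∈ Ioo (-1:ℝ) 1, HasDerivAt A1 (A2 r) r)
    (hp : ∀ r ∈ Ioo (-1:ℝ) 1, HasDerivAt p (p1 r) r)
    (hp1 : ∀ r ∈ Ioo (-1:ℝ) 1, HasDerivAt p1 (p2 r) r)
    (hAW : ∀ r ∈ Ioo (-1:ℝ) 1, r ^ 2 * A2 r + r * A1 r = W r * A r)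
    (hpW : ∀ r ∈ Ioo (-1:ℝ) 1, r ^ 2 * p2 r + r * p1 r = W r * p r)
    {r : ℝ} (hr : r ∈ Ioo (0:ℝ) 1) : A1 r * p r - A r * p1 r = 0 := by
  have hd : ∀ x ∈ Ioo (-1:ℝ) 1, HasDerivAt (fun x => x * (A1 x * p x - A x * p1 x))
      (1 * (A1 x * p x - A x * p1 x) +
        x * ((A2 x * p x + A1 x * p1 x) - (A1 x * p1 x + A x * p2 x))) x := fun x hx =>
    (hasDerivAt_id x).mul (((hA1 x hx).mul (hp x hx)).sub ((hA x hx).mul (hp1 x hx)))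
  have h := mvt0 hr.1 (f := fun x => x * (A1 x * p x - A x * p1 x))
    (fun x hx => (hd x ⟨by linarith [hx.1], by linarith [hx.2, hr.2]⟩).continuousAt.continuousWithinAt)
    (fun x hx => by
      have hx' : x ∈ Ioo (-1:ℝ) 1 := ⟨by linarith [hx.1], by linarith [hx.2, hr.2]⟩
      convert hd x hx' using 1
      have h1 := hAW x hx'
      have h2 := hpW x hx'
      have hx0 : x ≠ 0 := hx.1.ne'
      apply mul_left_cancel₀ hx0
      linear_combination A x * h2 - p x * h1)
  simp only [zero_mul, mul_eq_zero] at h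
  rcases h with h | h
  · exact absurd h hr.1.ne'
  · exact h

lemma ode0 {A A1 A2 : ℝ → ℝ}
    (hA : ∀ r ∈ Ioo (-1:ℝ) 1, HasDerivAt A (A1 r) r)
    (hA1 : ∀ r ∈ Ioo (-1:ℝ) 1, HasDerivAt A1 (A2 r) r)
    (hAW : ∀ r ∈ Ioo (-1:ℝ) 1, r ^ 2 * A2 r + r * A1 r = (8 * r ^ 2 / (1 - r ^ 2) ^ 2) * A r) :
    A (1/2) = 5 / 3 * A 0 := by
  have hne : ∀ r ∈ Ioo (-1:ℝ) 1, 1 - r ^ 2 ≠ 0 := fun r hr => by nlinarith [hr.1, hr.2]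
  have hp : ∀ r ∈ Ioo (-1:ℝ) 1, HasDerivAt (fun r : ℝ => (1 + r ^ 2) / (1 - r ^ 2))
      (4 * r / (1 - r ^ 2) ^ 2) r := fun r hr => by
    have := ((hasDerivAt_pow 2 r).const_add 1).div ((hasDerivAt_pow 2 r).const_sub 1) (hne r hr)
    refine HasDerivAt.congr_deriv this ?_
    have := hne r hr
    field_simp; push_cast; ring
  have hp1 : ∀ r ∈ Ioo (-1:ℝ) 1, HasDerivAt (fun r : ℝ => 4 * r / (1 - r ^ 2) ^ 2)
      ((4 + 12 * r ^ 2) / (1 - r ^ 2) ^ 3) r := fun r hr => by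
    have := ((hasDerivAt_id r).const_mul 4).div (((hasDerivAt_pow 2 r).const_sub 1).pow 2)
      (pow_ne_zero 2 (hne r hr))
    refine HasDerivAt.congr_deriv this ?_
    have := hne r hr
    simp only [id, Pi.pow_apply]
    field_simp; push_cast; ring
  have hw := fun r hr => wronsk (r := r) hA hA1 hp hp1 hAW (fun r hr => by
    have := hne r hr
    field_simp; ring) hr
  have hq : ∀ r ∈ Ioo (-1:ℝ) 1, HasDerivAt (fun r => A r / ((1 + r ^ 2) / (1 - r ^ 2))) _ r :=
    fun r hr => (hA r hr).div (hp r hr) (div_ne_zero (by positivity) (hne r hr))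
  have h := mvt0 (a := 0) (b := 1/2) (by norm_num)
    (fun x hx => (hq x ⟨by linarith [hx.1], by linarith [hx.2]⟩).continuousAt.continuousWithinAt)
    (fun x hx => by
      convert hq x ⟨by linarith [hx.1], by linarith [hx.2]⟩ using 1
      rw [hw x ⟨hx.1, by linarith [hx.2]⟩]; simp)
  norm_num at h
  linarith

lemma ode1 {A A1 A2 : ℝ → ℝ}
    (hA : ∀ r ∈ Ioo (-1:ℝ) 1, HasDerivAt A (A1 r) r)
    (hA1 : ∀ r ∈ Ioo (-1:ℝ) 1, HasDerivAt A1 (A2 r) r)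
    (hAW : ∀ r ∈ Ioo (-1:ℝ) 1,
      r ^ 2 * A2 r + r * A1 r = (8 * r ^ 2 / (1 - r ^ 2) ^ 2 + 1) * A r) (h0 : A 0 = 0) :
    A (1/2) = 2 / 3 * A1 0 := by
  have hne : ∀ r ∈ Ioo (-1:ℝ) 1, 1 - r ^ 2 ≠ 0 := fun r hr => by nlinarith [hr.1, hr.2]
  have hp : ∀ r ∈ Ioo (-1:ℝ) 1, HasDerivAt (fun r : ℝ => r / (1 - r ^ 2))
      ((1 + r ^ 2) / (1 - r ^ 2) ^ 2) r := fun r hr => by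
    have := (hasDerivAt_id r).div ((hasDerivAt_pow 2 r).const_sub 1) (hne r hr)
    refine HasDerivAt.congr_deriv this ?_
    have := hne r hr
    simp only [id]
    field_simp; push_cast; ring
  have hp1 : ∀ r ∈ Ioo (-1:ℝ) 1, HasDerivAt (fun r : ℝ => (1 + r ^ 2) / (1 - r ^ 2) ^ 2)
      ((6 * r + 2 * r ^ 3) / (1 - r ^ 2) ^ 3) r := fun r hr => by
    have := ((hasDerivAt_pow 2 r).const_add 1).div (((hasDerivAt_pow 2 r).const_sub 1).pow 2)
      (pow_ne_zero 2 (hne r hr))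
    refine HasDerivAt.congr_deriv this ?_
    have := hne r hr
    simp only [Pi.pow_apply]
    field_simp; push_cast; ring
  have hw := fun r hr => wronsk (r := r) hA hA1 hp hp1 hAW (fun r hr => by
    have := hne r hr
    field_simp; ring) hr
  have hq : ∀ r ∈ Ioo (0:ℝ) 1, HasDerivAt (fun r => A r / (r / (1 - r ^ 2))) _ r :=
    fun r hr => (hA r ⟨by linarith [hr.1], hr.2⟩).div (hp r ⟨by linarith [hr.1], hr.2⟩)
      (div_ne_zero hr.1.ne' (hne r ⟨by linarith [hr.1], hr.2⟩))
  have h : ∀ r ∈ Ioo (0:ℝ) (1/2), A (1/2) * (3/2) = A r / (r / (1 - r ^ 2)) := fun r hr => by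
    have h := mvt0 (a := r) (b := 1/2) hr.2
      (fun x hx => (hq x ⟨by linarith [hx.1, hr.1], by linarith [hx.2]⟩).continuousAt.continuousWithinAt)
      (fun x hx => by
        convert hq x ⟨by linarith [hx.1, hr.1], by linarith [hx.2]⟩ using 1
        rw [hw x ⟨by linarith [hx.1, hr.1], by linarith [hx.2]⟩]; simp)
    rw [← h]; norm_num; ring
  have hG : HasDerivAt (fun r => A r * (1 - r ^ 2)) (A1 0) 0 := by
    have := (hA 0 (by norm_num)).mul ((hasDerivAt_pow 2 (0:ℝ)).const_sub 1)
    refine HasDerivAt.congr_deriv this ?_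
    simp
  have hG' : HasDerivWithinAt (fun r => A r * (1 - r ^ 2)) (A (1/2) * (3/2)) (Ioo 0 (1/2)) 0 := by
    have h2 : HasDerivWithinAt (fun r : ℝ => A (1/2) * (3/2) * r) (A (1/2) * (3/2)) (Ioo 0 (1/2)) 0 := by
      simpa using ((hasDerivAt_id (0:ℝ)).const_mul (A (1/2) * (3/2))).hasDerivWithinAt
    refine h2.congr (fun x hx => ?_) (by simp [h0])
    rw [h x hx]
    have := hne x ⟨by linarith [hx.1], by linarith [hx.2]⟩
    have := hx.1.ne'
    field_simp
  have huniq : UniqueDiffWithinAt ℝ (Ioo (0:ℝ) (1/2)) 0 :=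
    uniqueDiffWithinAt_convex (convex_Ioo _ _) (by simp) (by
      rw [closure_Ioo (by norm_num)]; norm_num)
  have := huniq.eq_deriv _ hG.hasDerivWithinAt hG'
  linarith

/-- Angular moments of a solution in polar coordinates. -/
lemma moment {v v1 v2 vt vtt : ℝ → ℝ → ℝ} {k k1 : ℝ → ℝ} {n : ℝ}
    (hv : ContinuousOn (Function.uncurry v) (Ioo (-1:ℝ) 1 ×ˢ univ))
    (hv1 : ContinuousOn (Function.uncurry v1) (Ioo (-1:ℝ) 1 ×ˢ univ))
    (hv2 : ContinuousOn (Function.uncurry v2) (Ioo (-1:ℝ) 1 ×ˢ univ))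
    (d1 : ∀ r ∈ Ioo (-1:ℝ) 1, ∀ t, HasDerivAt (fun r => v r t) (v1 r t) r)
    (d2 : ∀ r ∈ Ioo (-1:ℝ) 1, ∀ t, HasDerivAt (fun r => v1 r t) (v2 r t) r)
    (dt : ∀ r ∈ Ioo (-1:ℝ) 1, ∀ t, HasDerivAt (v r) (vt r t) t)
    (dtt : ∀ r ∈ Ioo (-1:ℝ) 1, ∀ t, HasDerivAt (vt r) (vtt r t) t)
    (pv : ∀ r, v r (2 * Real.pi) = v r 0) (pvt : ∀ r, vt r (2 * Real.pi) = vt r 0)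
    (pde : ∀ r ∈ Ioo (-1:ℝ) 1, ∀ t,
      r ^ 2 * v2 r t + r * v1 r t + vtt r t = (8 * r ^ 2 / (1 - r ^ 2) ^ 2) * v r t)
    (hk : ∀ t, HasDerivAt k (k1 t) t) (hk1 : ∀ t, HasDerivAt k1 (-(n * k t)) t)
    (pk : k (2 * Real.pi) = k 0) (pk1 : k1 (2 * Real.pi) = k1 0) :
    (∀ r ∈ Ioo (-1:ℝ) 1, HasDerivAt (fun r => ∫ t in (0:ℝ)..(2 * Real.pi), v r t * k t)
      (∫ t in (0:ℝ)..(2 * Real.pi), v1 r t * k t) r) ∧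
    (∀ r ∈ Ioo (-1:ℝ) 1, HasDerivAt (fun r => ∫ t in (0:ℝ)..(2 * Real.pi), v1 r t * k t)
      (∫ t in (0:ℝ)..(2 * Real.pi), v2 r t * k t) r) ∧
    (∀ r ∈ Ioo (-1:ℝ) 1, r ^ 2 * (∫ t in (0:ℝ)..(2 * Real.pi), v2 r t * k t)
      + r * (∫ t in (0:ℝ)..(2 * Real.pi), v1 r t * k t)
      = (8 * r ^ 2 / (1 - r ^ 2) ^ 2 + n) * ∫ t in (0:ℝ)..(2 * Real.pi), v r t * k t) := by
  have kc : Continuous k := continuous_iff_continuousAt.2 fun t => (hk t).continuousAt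
  have slice : ∀ {w : ℝ → ℝ → ℝ}, ContinuousOn (Function.uncurry w) (Ioo (-1:ℝ) 1 ×ˢ univ) →
      ∀ r ∈ Ioo (-1:ℝ) 1, Continuous (w r) := fun {w} hw r hr =>
    hw.comp_continuous (f := fun t : ℝ => ((r, t) : ℝ × ℝ)) (by fun_prop)
      (fun t => ⟨hr, mem_univ _⟩)
  have mulk : ∀ {w : ℝ → ℝ → ℝ}, ContinuousOn (Function.uncurry w) (Ioo (-1:ℝ) 1 ×ˢ univ) →
      ContinuousOn (Function.uncurry fun r t => w r t * k t) (Ioo (-1:ℝ) 1 ×ˢ univ) :=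
    fun {w} hw => ContinuousOn.mul hw (kc.comp continuous_snd).continuousOn
  refine ⟨fun r hr => ?_, fun r hr => ?_, fun r hr => ?_⟩
  · exact param_deriv (fun r hr => (slice hv r hr).mul kc) (mulk hv1)
      (fun r hr t => (d1 r hr t).mul_const _) hr _
  · exact param_deriv (fun r hr => (slice hv1 r hr).mul kc) (mulk hv2)
      (fun r hr t => (d2 r hr t).mul_const _) hr _
  · have c0 := (slice hv r hr).mul kc
    have c1 := (slice hv1 r hr).mul kc
    have c2 := (slice hv2 r hr).mul kc
    have e : ∀ t, HasDerivAt (fun t => vt r t * k t - v r t * k1 t)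
        ((8 * r ^ 2 / (1 - r ^ 2) ^ 2 + n) * (v r t * k t) - r ^ 2 * (v2 r t * k t)
          - r * (v1 r t * k t)) t := fun t => by
      refine (((dtt r hr t).mul (hk t)).sub ((dt r hr t).mul (hk1 t))).congr_deriv ?_
      linear_combination k t * pde r hr t
    have i := intervalIntegral.integral_eq_sub_of_hasDerivAt (a := 0) (b := 2 * Real.pi)
      (fun t _ => e t) (Continuous.intervalIntegrable
        (((continuous_const.mul c0).sub (continuous_const.mul c2)).sub (continuous_const.mul c1)) _ _)
    rw [intervalIntegral.integral_sub, intervalIntegral.integral_sub,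
      intervalIntegral.integral_const_mul, intervalIntegral.integral_const_mul,
      intervalIntegral.integral_const_mul, pv, pvt, pk, pk1] at i
    · linarith
    · exact (continuous_const.mul c0).intervalIntegrable _ _
    · exact (continuous_const.mul c2).intervalIntegrable _ _
    · exact ((continuous_const.mul c0).sub (continuous_const.mul c2)).intervalIntegrable _ _
    · exact (continuous_const.mul c1).intervalIntegrable _ _

lemma polar_bound {v v1 v2 vt vtt : ℝ → ℝ → ℝ} {a b c : ℝ}
    (hv : ContinuousOn (Function.uncurry v) (Ioo (-1:ℝ) 1 ×ˢ univ))
    (hv1 : ContinuousOn (Function.uncurry v1) (Ioo (-1:ℝ) 1 ×ˢ univ))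
    (hv2 : ContinuousOn (Function.uncurry v2) (Ioo (-1:ℝ) 1 ×ˢ univ))
    (d1 : ∀ r ∈ Ioo (-1:ℝ) 1, ∀ t, HasDerivAt (fun r => v r t) (v1 r t) r)
    (d2 : ∀ r ∈ Ioo (-1:ℝ) 1, ∀ t, HasDerivAt (fun r => v1 r t) (v2 r t) r)
    (dt : ∀ r ∈ Ioo (-1:ℝ) 1, ∀ t, HasDerivAt (v r) (vt r t) t)
    (dtt : ∀ r ∈ Ioo (-1:ℝ) 1, ∀ t, HasDerivAt (vt r) (vtt r t) t)
    (pv : ∀ r, v r (2 * Real.pi) = v r 0) (pvt : ∀ r, vt r (2 * Real.pi) = vt r 0)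
    (pde : ∀ r ∈ Ioo (-1:ℝ) 1, ∀ t,
      r ^ 2 * v2 r t + r * v1 r t + vtt r t = (8 * r ^ 2 / (1 - r ^ 2) ^ 2) * v r t)
    (pos : ∀ r ∈ Ioo (-1:ℝ) 1, ∀ t, 0 ≤ v r t)
    (v0 : ∀ t, v 0 t = c) (v10 : ∀ t, v1 0 t = Real.cos t * a + Real.sin t * b) :
    |a| ≤ 5 * c := by
  obtain ⟨A1, A2, A3⟩ := moment (k := fun _ => 1) (k1 := fun _ => 0) (n := 0)
    hv hv1 hv2 d1 d2 dt dtt pv pvt pde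
    (fun t => hasDerivAt_const _ _) (fun t => by simpa using hasDerivAt_const t (0:ℝ)) rfl rfl
  obtain ⟨B1, B2, B3⟩ := moment (k := Real.cos) (k1 := fun t => - Real.sin t) (n := 1)
    hv hv1 hv2 d1 d2 dt dtt pv pvt pde
    (fun t => Real.hasDerivAt_cos t) (fun t => (Real.hasDerivAt_sin t).neg.congr_deriv (by simp))
    (by simp) (by simp)
  have hA := ode0 A1 A2 (fun r hr => by simpa using A3 r hr)
  have hB := ode1 B1 B2 B3 (by simp [v0])
  have hs : Continuous (v (1/2)) :=
    hv.comp_continuous (f := fun t : ℝ => (((1/2 : ℝ), t) : ℝ × ℝ)) (by fun_prop)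
      (fun t => ⟨by norm_num, mem_univ _⟩)
  have hAB : |∫ t in (0:ℝ)..(2 * Real.pi), v (1/2) t * Real.cos t|
      ≤ ∫ t in (0:ℝ)..(2 * Real.pi), v (1/2) t * 1 := by
    refine (intervalIntegral.abs_integral_le_integral_abs (by positivity)).trans ?_
    refine intervalIntegral.integral_mono_on (by positivity)
      (Continuous.intervalIntegrable (by fun_prop) _ _)
      (Continuous.intervalIntegrable (by fun_prop) _ _) (fun t _ => ?_)
    have := pos (1/2) (by norm_num) t
    rw [abs_mul, abs_of_nonneg this]
    exact mul_le_mul_of_nonneg_left (Real.abs_cos_le_one t) this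
  have hI : (∫ t in (0:ℝ)..(2 * Real.pi), v1 0 t * Real.cos t) = Real.pi * a := by
    have : ∀ t, v1 0 t * Real.cos t = a * Real.cos t ^ 2 + b * (Real.sin t * Real.cos t) :=
      fun t => by rw [v10]; ring
    simp only [this]
    rw [intervalIntegral.integral_add, intervalIntegral.integral_const_mul,
      intervalIntegral.integral_const_mul, integral_cos_sq, integral_sin_mul_cos₁]
    · simp; ring
    · exact Continuous.intervalIntegrable (by fun_prop) _ _
    · exact Continuous.intervalIntegrable (by fun_prop) _ _
  rw [hA, hB, hI] at hAB
  simp only [v0, intervalIntegral.integral_const, sub_zero, smul_eq_mul, mul_one] at hAB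
  rw [abs_mul, abs_mul, abs_of_pos Real.pi_pos, abs_of_pos (by norm_num : (0:ℝ) < 2/3)] at hAB
  have := Real.pi_pos
  by_contra! hcon
  nlinarith [mul_lt_mul_of_pos_left hcon this]

/-- second derivative of a real function along a curve -/
lemma curve2 {u : ℂ → ℝ} {γ γ1 : ℝ → ℂ} {γ2 : ℂ} {t : ℝ} (hu : ContDiffAt ℝ 2 u (γ t))
    (h : HasDerivAt γ (γ1 t) t) (h1 : HasDerivAt γ1 γ2 t) :
    HasDerivAt (fun t => fderiv ℝ u (γ t) (γ1 t))
      (fderiv ℝ (fderiv ℝ u) (γ t) (γ1 t) (γ1 t) + fderiv ℝ u (γ t) γ2) t := by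
  have hd : DifferentiableAt ℝ (fderiv ℝ u) (γ t) :=
    (hu.fderiv_right (m := 1) (by norm_num)).differentiableAt (by norm_num)
  exact (hd.hasFDerivAt.comp_hasDerivAt t h).clm_apply h1

lemma lap_conf {u : ℂ → ℝ} {z : ℂ} (hu : ContDiffAt ℝ 2 u z) (a : ℂ) :
    fderiv ℝ (fderiv ℝ u) z a a + fderiv ℝ (fderiv ℝ u) z (Complex.I * a) (Complex.I * a)
      = ‖a‖ ^ 2 * lapE u z := by
  have hd : DifferentiableAt ℝ (fderiv ℝ u) z :=
    (hu.fderiv_right (m := 1) (by norm_num)).differentiableAt (by norm_num)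
  have hl : ∀ w : ℂ, fderiv ℝ (fun x => fderiv ℝ u x w) z w = fderiv ℝ (fderiv ℝ u) z w w := by
    intro w
    rw [(hd.hasFDerivAt.clm_apply (hasFDerivAt_const w z)).fderiv]
    simp
  unfold lapE
  rw [hl, hl]
  obtain ⟨x, y⟩ := a
  have e1 : (⟨x, y⟩ : ℂ) = x • (1:ℂ) + y • Complex.I := by
    apply Complex.ext <;> simp
  have e2 : Complex.I * (⟨x, y⟩ : ℂ) = x • Complex.I - y • (1:ℂ) := by
    apply Complex.ext <;> simp
  rw [e2, Complex.sq_norm, Complex.normSq_mk, e1]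
  simp only [map_add, map_sub, map_smul, add_apply,
    sub_apply, smul_apply, smul_eq_mul]
  ring

lemma key {u : ℂ → ℝ} {m : ℂ → ℂ}
    (hu : ContDiffOn ℝ 2 u (Metric.ball (0 : ℂ) 1))
    (pos : ∀ z ∈ Metric.ball (0 : ℂ) 1, 0 < u z)
    (pde : ∀ z ∈ Metric.ball (0 : ℂ) 1, lapE u z = 8 / (1 - ‖z‖ ^ 2) ^ 2 * u z)
    (hm : DifferentiableOn ℂ m (Metric.ball (0 : ℂ) 1))
    (maps : ∀ z ∈ Metric.ball (0 : ℂ) 1, m z ∈ Metric.ball (0 : ℂ) 1)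
    (iso : ∀ z ∈ Metric.ball (0 : ℂ) 1,
      ‖deriv m z‖ ^ 2 * (1 - ‖z‖ ^ 2) ^ 2 = (1 - ‖m z‖ ^ 2) ^ 2) :
    |fderiv ℝ u (m 0) (deriv m 0)| ≤ 5 * u (m 0) := by
  have ob : IsOpen (Metric.ball (0 : ℂ) 1) := Metric.isOpen_ball
  have hua : ∀ z ∈ Metric.ball (0 : ℂ) 1, ContDiffAt ℝ 2 u z := fun z hz =>
    hu.contDiffAt (ob.mem_nhds hz)
  have hm1 : DifferentiableOn ℂ (deriv m) (Metric.ball (0 : ℂ) 1) := hm.deriv ob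
  have hm2 : DifferentiableOn ℂ (deriv (deriv m)) (Metric.ball (0 : ℂ) 1) := hm1.deriv ob
  have dm : ∀ z ∈ Metric.ball (0 : ℂ) 1, HasDerivAt m (deriv m z) z := fun z hz =>
    (hm.differentiableAt (ob.mem_nhds hz)).hasDerivAt
  have dm1 : ∀ z ∈ Metric.ball (0 : ℂ) 1, HasDerivAt (deriv m) (deriv (deriv m) z) z := fun z hz =>
    (hm1.differentiableAt (ob.mem_nhds hz)).hasDerivAt
  set E : ℝ → ℂ := fun t => Complex.exp (t * Complex.I) with hE
  have En : ∀ t, ‖E t‖ = 1 := fun t => Complex.norm_exp_ofReal_mul_I t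
  have Ec : Continuous E := by fun_prop
  have inb : ∀ r ∈ Ioo (-1:ℝ) 1, ∀ t, (r:ℂ) * E t ∈ Metric.ball (0 : ℂ) 1 := fun r hr t => by
    rw [mem_ball_zero_iff, norm_mul, En, mul_one, Complex.norm_real, Real.norm_eq_abs, abs_lt]
    exact hr
  have Ed : ∀ t, HasDerivAt E (Complex.I * E t) t := fun t => by
    have h1 : HasDerivAt (fun t : ℝ => (t:ℂ) * Complex.I) Complex.I t := by
      simpa using (Complex.ofRealCLM.hasDerivAt (x := t)).mul_const Complex.I
    exact h1.cexp.congr_deriv (mul_comm _ _)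
  have Rd : ∀ (t r : ℝ), HasDerivAt (fun r : ℝ => (r:ℂ) * E t) (E t) r := fun t r => by
    simpa using (Complex.ofRealCLM.hasDerivAt (x := r)).mul_const (E t)
  have Td : ∀ (r t : ℝ), HasDerivAt (fun t : ℝ => (r:ℂ) * E t) (Complex.I * (r * E t)) t :=
    fun r t => ((Ed t).const_mul (r:ℂ)).congr_deriv (by ring)
  have E2 : E (2 * Real.pi) = E 0 := by simp [hE, Complex.exp_two_pi_mul_I]
  -- continuity
  have cP : ContinuousOn (fun p : ℝ × ℝ => (p.1:ℂ) * E p.2) (Ioo (-1:ℝ) 1 ×ˢ univ) := by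
    apply Continuous.continuousOn; fun_prop
  have mP : MapsTo (fun p : ℝ × ℝ => (p.1:ℂ) * E p.2) (Ioo (-1:ℝ) 1 ×ˢ univ)
      (Metric.ball (0 : ℂ) 1) := fun p hp => inb p.1 hp.1 p.2
  have cE : ContinuousOn (fun p : ℝ × ℝ => E p.2) (Ioo (-1:ℝ) 1 ×ˢ univ) := by
    apply Continuous.continuousOn; fun_prop
  have cm := hm.continuousOn.comp cP mP
  have cm1 := hm1.continuousOn.comp cP mP
  have cm2 := hm2.continuousOn.comp cP mP
  have mm : MapsTo (m ∘ fun p : ℝ × ℝ => (p.1:ℂ) * E p.2) (Ioo (-1:ℝ) 1 ×ˢ univ)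
      (Metric.ball (0 : ℂ) 1) := fun p hp => maps _ (mP hp)
  have hu1 : ContDiffOn ℝ 1 (fderiv ℝ u) (Metric.ball (0 : ℂ) 1) :=
    hu.fderiv_of_isOpen ob (by norm_num)
  have cu := hu.continuousOn.comp cm mm
  have cu1 := hu1.continuousOn.comp cm mm
  have cu2 := (hu1.continuousOn_fderiv_of_isOpen ob (by norm_num)).comp cm mm
  have main := polar_bound
    (v := fun r t => u (m (r * E t)))
    (v1 := fun r t => fderiv ℝ u (m (r * E t)) (deriv m (r * E t) * E t))
    (v2 := fun r t => fderiv ℝ (fderiv ℝ u) (m (r * E t))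
        (deriv m (r * E t) * E t) (deriv m (r * E t) * E t)
      + fderiv ℝ u (m (r * E t)) (deriv (deriv m) (r * E t) * E t * E t))
    (vt := fun r t => fderiv ℝ u (m (r * E t)) (deriv m (r * E t) * (Complex.I * (r * E t))))
    (vtt := fun r t => fderiv ℝ (fderiv ℝ u) (m (r * E t))
        (deriv m (r * E t) * (Complex.I * (r * E t))) (deriv m (r * E t) * (Complex.I * (r * E t)))
      + fderiv ℝ u (m (r * E t))
        (-(deriv (deriv m) (r * E t) * (r * E t) * (r * E t)) - deriv m (r * E t) * (r * E t)))
    (a := fderiv ℝ u (m 0) (deriv m 0)) (b := fderiv ℝ u (m 0) (deriv m 0 * Complex.I))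
    (c := u (m 0))
    cu (cu1.clm_apply (cm1.mul cE))
    (((cu2.clm_apply (cm1.mul cE)).clm_apply (cm1.mul cE)).add
      (cu1.clm_apply ((cm2.mul cE).mul cE)))
    (fun r hr t => by
      have := (dm _ (inb r hr t)).comp r (Rd t r)
      exact ((hua _ (maps _ (inb r hr t))).differentiableAt
        (by norm_num)).hasFDerivAt.comp_hasDerivAt r this)
    (fun r hr t => by
      have g := (dm _ (inb r hr t)).comp r (Rd t r)
      have g1 := ((dm1 _ (inb r hr t)).comp r (Rd t r)).mul_const (E t)
      exact curve2 (γ := fun r : ℝ => m (r * E t)) (γ1 := fun r : ℝ => deriv m (r * E t) * E t)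
        (hua _ (maps _ (inb r hr t))) g g1)
    (fun r hr t => by
      have := (dm _ (inb r hr t)).comp t (Td r t)
      exact ((hua _ (maps _ (inb r hr t))).differentiableAt
        (by norm_num)).hasFDerivAt.comp_hasDerivAt t this)
    (fun r hr t => by
      have g := (dm _ (inb r hr t)).comp t (Td r t)
      have g1 := ((dm1 _ (inb r hr t)).comp t (Td r t)).mul ((Td r t).const_mul Complex.I)
      refine curve2 (γ := fun t : ℝ => m (r * E t))
        (γ1 := fun t : ℝ => deriv m (r * E t) * (Complex.I * (r * E t)))
        (hua _ (maps _ (inb r hr t))) g (HasDerivAt.congr_deriv g1 ?_)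
      simp only [Function.comp]
      linear_combination (deriv (deriv m) (r * E t) * (r * E t) * (r * E t)
        + deriv m (r * E t) * (r * E t)) * Complex.I_mul_I)
    (fun r => by simp only [E2]) (fun r => by simp only [E2])
    (fun r hr t => by
      have hz := inb r hr t
      have hmz := maps _ hz
      have hlap := lap_conf (hua _ hmz) (deriv m (r * E t) * (r * E t))
      have hnz : ‖(r:ℂ) * E t‖ ^ 2 = r ^ 2 := by
        rw [norm_mul, En, mul_one, Complex.norm_real, Real.norm_eq_abs, sq_abs]
      have hi := iso _ hz
      rw [hnz] at hi
      have hp : 1 - ‖m (r * E t)‖ ^ 2 ≠ 0 := by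
        rw [mem_ball_zero_iff] at hmz
        nlinarith [norm_nonneg (m (r * E t))]
      have hr1 : 1 - r ^ 2 ≠ 0 := by nlinarith [hr.1, hr.2]
      rw [pde _ hmz, norm_mul, mul_pow, hnz] at hlap
      have e1 : deriv m (r * E t) * (r * E t) = r • (deriv m (r * E t) * E t) := by
        rw [Complex.real_smul]; ring
      have e2 : Complex.I * (deriv m (r * E t) * (r * E t))
          = deriv m (r * E t) * (Complex.I * (r * E t)) := by ring
      have e3 : deriv (deriv m) (r * E t) * (r * E t) * (r * E t)
          = (r ^ 2) • (deriv (deriv m) (r * E t) * E t * E t) := by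
        rw [Complex.real_smul]; push_cast; ring
      rw [e2, e1] at hlap
      rw [e3, e1]
      simp only [map_sub, map_neg, map_smul, smul_apply, smul_eq_mul] at hlap ⊢
      have hfin : ‖deriv m (r * E t)‖ ^ 2 * r ^ 2 * (8 / (1 - ‖m (r * E t)‖ ^ 2) ^ 2 * u (m (r * E t)))
          = 8 * r ^ 2 / (1 - r ^ 2) ^ 2 * u (m (r * E t)) := by
        have hq : ‖deriv m (r * E t)‖ ^ 2 ≠ 0 := by
          intro h
          rw [h, zero_mul] at hi
          exact hp (pow_eq_zero_iff (two_ne_zero) |>.1 hi.symm)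
        have hq' : ‖deriv m (r * E t)‖ ≠ 0 := fun h => hq (by rw [h]; norm_num)
        rw [← hi]
        field_simp
      rw [← hfin, ← hlap]
      ring)
    (fun r hr t => (pos _ (maps _ (inb r hr t))).le)
    (fun t => by simp)
    (fun t => by
      have : deriv m 0 * E t
          = Real.cos t • deriv m 0 + Real.sin t • (deriv m 0 * Complex.I) := by
        simp only [hE, Complex.exp_mul_I, Complex.real_smul]
        push_cast; ring
      simp only [Complex.ofReal_zero, zero_mul, this, map_add, map_smul, smul_eq_mul])
  exact main

lemma mobius {u : ℂ → ℝ}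
    (hu : ContDiffOn ℝ 2 u (Metric.ball (0 : ℂ) 1))
    (pos : ∀ z ∈ Metric.ball (0 : ℂ) 1, 0 < u z)
    (pde : ∀ z ∈ Metric.ball (0 : ℂ) 1, lapE u z = 8 / (1 - ‖z‖ ^ 2) ^ 2 * u z)
    {p c : ℂ} (hp : p ∈ Metric.ball (0 : ℂ) 1) (hc : ‖c‖ = 1) :
    (1 - ‖p‖ ^ 2) * |fderiv ℝ u p c| ≤ 5 * u p := by
  have hp1 : ‖p‖ < 1 := mem_ball_zero_iff.1 hp
  have hD : ∀ z ∈ Metric.ball (0 : ℂ) 1, 1 + (starRingEnd ℂ) p * (c * z) ≠ 0 := fun z hz h => by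
    have hz1 : ‖z‖ < 1 := mem_ball_zero_iff.1 hz
    have h1 : (starRingEnd ℂ) p * (c * z) = -1 := by linear_combination h
    have h2 := congrArg norm h1
    rw [norm_mul, norm_mul, hc, RCLike.norm_conj, norm_neg, norm_one, one_mul] at h2
    nlinarith [norm_nonneg z, norm_nonneg p]
  have hd : ∀ z ∈ Metric.ball (0 : ℂ) 1,
      HasDerivAt (fun z => (p + c * z) / (1 + (starRingEnd ℂ) p * (c * z)))
        (c * (1 - (starRingEnd ℂ) p * p) / (1 + (starRingEnd ℂ) p * (c * z)) ^ 2) z := fun z hz => by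
    have h1 : HasDerivAt (fun z => p + c * z) c z := by
      simpa using ((hasDerivAt_id z).const_mul c).const_add p
    have h2 : HasDerivAt (fun z => 1 + (starRingEnd ℂ) p * (c * z)) ((starRingEnd ℂ) p * c) z := by
      simpa using (((hasDerivAt_id z).const_mul c).const_mul ((starRingEnd ℂ) p)).const_add 1
    refine (h1.div h2 (hD z hz)).congr_deriv ?_
    congr 1
    ring
  have hid : ∀ z ∈ Metric.ball (0 : ℂ) 1,
      1 - ‖(p + c * z) / (1 + (starRingEnd ℂ) p * (c * z))‖ ^ 2
        = (1 - ‖p‖ ^ 2) * (1 - ‖z‖ ^ 2) / ‖1 + (starRingEnd ℂ) p * (c * z)‖ ^ 2 := fun z hz => by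
    have h0 : ‖1 + (starRingEnd ℂ) p * (c * z)‖ ≠ 0 := norm_ne_zero_iff.2 (hD z hz)
    have hcz : ‖z‖ = ‖c * z‖ := by rw [norm_mul, hc, one_mul]
    rw [hcz, norm_div, div_pow, eq_div_iff (pow_ne_zero 2 h0), sub_mul,
      div_mul_cancel₀ _ (pow_ne_zero 2 h0)]
    simp only [Complex.sq_norm, Complex.normSq_apply]
    simp
    ring
  have hpp : 0 < 1 - ‖p‖ ^ 2 := by nlinarith [norm_nonneg p]
  have hn : ‖1 - (starRingEnd ℂ) p * p‖ = 1 - ‖p‖ ^ 2 := by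
    rw [← Complex.normSq_eq_conj_mul_self, ← Complex.sq_norm, ← Complex.ofReal_one,
      ← Complex.ofReal_sub, Complex.norm_real, Real.norm_eq_abs, abs_of_pos hpp]
  have h := key hu pos pde (m := fun z => (p + c * z) / (1 + (starRingEnd ℂ) p * (c * z)))
    (fun z hz => (hd z hz).differentiableAt.differentiableWithinAt)
    (fun z hz => by
      have hz1 : ‖z‖ < 1 := mem_ball_zero_iff.1 hz
      have h0 : 0 < ‖1 + (starRingEnd ℂ) p * (c * z)‖ := norm_pos_iff.2 (hD z hz)
      have : 0 < 1 - ‖z‖ ^ 2 := by nlinarith [norm_nonneg z]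
      have h2 : 0 < (1 - ‖p‖ ^ 2) * (1 - ‖z‖ ^ 2) / ‖1 + (starRingEnd ℂ) p * (c * z)‖ ^ 2 := by
        positivity
      rw [← hid z hz] at h2
      rw [mem_ball_zero_iff]
      by_contra! hcon
      nlinarith)
    (fun z hz => by
      have h0 : ‖1 + (starRingEnd ℂ) p * (c * z)‖ ≠ 0 := norm_ne_zero_iff.2 (hD z hz)
      rw [(hd z hz).deriv, hid z hz, norm_div, norm_mul, hc, hn, norm_pow]
      field_simp)
  rw [(hd 0 (by simp)).deriv] at h
  have e : c * (1 - (starRingEnd ℂ) p * p) / (1 + (starRingEnd ℂ) p * (c * 0)) ^ 2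
      = (1 - ‖p‖ ^ 2) • c := by
    rw [← Complex.normSq_eq_conj_mul_self, ← Complex.sq_norm, Complex.real_smul]
    push_cast
    simp [mul_comm]
  rw [e] at h
  simp only [mul_zero, add_zero, div_one, map_smul, smul_eq_mul] at h
  rwa [abs_mul, abs_of_pos hpp] at h

/-- Li–Yau gradient estimate: there is a universal constant C₀ such that every positive
smooth solution of Δu - 2u = 0 on the hyperbolic plane (realized as the Poincaré disk,
where Δ_g u = e^{-2f} Δ_Euc u and ‖grad_g u‖_g = e^{-f}‖grad_Euc u‖) satisfies
‖grad u‖/u ≤ C₀ everywhere. -/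
theorem stmt18 :
    ∃ C₀ : ℝ, ∀ u : ℂ → ℝ,
      ContDiffOn ℝ (⊤ : ℕ∞) u (Metric.ball (0 : ℂ) 1) →
      (∀ z ∈ Metric.ball (0 : ℂ) 1, 0 < u z) →
      -- Δ_{H²} u = 2u, i.e. Δ_Euc u = 2 e^{2f} u
      (∀ z ∈ Metric.ball (0 : ℂ) 1, lapE u z = 2 * Real.exp (2 * fconf z) * u z) →
      -- the hyperbolic gradient norm: ‖grad_{H²} u‖ = e^{-f} ‖grad_Euc u‖ ≤ C₀ u
      ∀ z ∈ Metric.ball (0 : ℂ) 1,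
        Real.exp (-(fconf z)) * gradNormE u z ≤ C₀ * u z := by
  refine ⟨5, fun u hu pos pde z hz => ?_⟩
  have hpos : ∀ z ∈ Metric.ball (0 : ℂ) 1, 0 < 1 - ‖z‖ ^ 2 := fun z hz => by
    have : ‖z‖ < 1 := mem_ball_zero_iff.1 hz
    nlinarith [norm_nonneg z]
  have hexp : ∀ z ∈ Metric.ball (0 : ℂ) 1, Real.exp (fconf z) = 2 / (1 - ‖z‖ ^ 2) := fun z hz =>
    Real.exp_log (div_pos two_pos (hpos z hz))
  have hu2 : ContDiffOn ℝ 2 u (Metric.ball (0 : ℂ) 1) := hu.of_le (WithTop.coe_le_coe.2 (le_top : (2:ℕ∞) ≤ ⊤))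
  have pde2 : ∀ z ∈ Metric.ball (0 : ℂ) 1, lapE u z = 8 / (1 - ‖z‖ ^ 2) ^ 2 * u z := fun z hz => by
    rw [pde z hz, two_mul (fconf z), Real.exp_add, hexp z hz]
    have := (hpos z hz).ne'
    field_simp
    ring
  have h1 := mobius hu2 pos pde2 hz (c := 1) (by simp)
  have h2 := mobius hu2 pos pde2 hz (c := Complex.I) (by simp)
  have hg : gradNormE u z ≤ |fderiv ℝ u z 1| + |fderiv ℝ u z Complex.I| := by
    unfold gradNormE
    rw [Real.sqrt_le_left (by positivity), add_sq, sq_abs, sq_abs]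
    have : 0 ≤ 2 * |fderiv ℝ u z 1| * |fderiv ℝ u z Complex.I| := by positivity
    linarith
  have hz' := hpos z hz
  have := mul_le_mul_of_nonneg_left hg hz'.le
  rw [Real.exp_neg, hexp z hz, inv_div]
  linarith
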